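/- For every d ≥ 2 there exists a constant r ∈ ℕ (depending only on d) such that for every finite subset Σ ⊆ SL_d(ℤ) with 1 ∈ Σ generating a subgroup that is Zariski dense in SL_d, there exists γ ∈ SL_d(ℤ) with max_{σ ∈ Σ} ‖γ σ γ⁻¹‖ ≤ max_{a ∈ Σ^r} Λ(a), where Λ(a) denotes the spectral radius of a. That is, Σ can be conjugated by an integer matrix γ so that its norm is bounded by the largest eigenvalue absolute value appearing among products of at most r elements of Σ. -/

import Mathlib

open scoped Pointwise

/-- The operator norm of a real matrix, induced by the Euclidean norm on `ℝ^d`. -/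
noncomputable def opNormR {d : ℕ} (A : Matrix (Fin d) (Fin d) ℝ) : ℝ :=
  ‖LinearMap.toContinuousLinearMap (Matrix.toEuclideanLin A)‖

/-- The real matrix associated to an element of `SL_d(ℤ)`. -/
def intMat {d : ℕ} (γ : Matrix.SpecialLinearGroup (Fin d) ℤ) : Matrix (Fin d) (Fin d) ℝ :=
  (γ : Matrix (Fin d) (Fin d) ℤ).map ((↑) : ℤ → ℝ)

/-- The spectral radius (maximal absolute value of the complex eigenvalues) of an
integer matrix. -/
noncomputable def LamZ {d : ℕ} (a : Matrix.SpecialLinearGroup (Fin d) ℤ) : ℝ :=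
  (spectralRadius ℂ ((a : Matrix (Fin d) (Fin d) ℤ).map ((↑) : ℤ → ℂ))).toReal

/-- A subgroup of `SL_d(ℤ)` is Zariski dense in `SL_d` if every polynomial with rational
coefficients in the matrix entries vanishing on the subgroup vanishes on all of `SL_d(ℂ)`. -/
def ZariskiDenseSLZ (d : ℕ) (Δ : Subgroup (Matrix.SpecialLinearGroup (Fin d) ℤ)) : Prop :=
  ∀ p : MvPolynomial (Fin d × Fin d) ℚ,
    (∀ γ ∈ Δ, MvPolynomial.aeval
        (fun ij : Fin d × Fin d =>
          (((γ : Matrix (Fin d) (Fin d) ℤ) ij.1 ij.2 : ℤ) : ℚ)) p = 0) →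
    ∀ g : Matrix.SpecialLinearGroup (Fin d) ℂ,
      MvPolynomial.aeval
        (fun ij : Fin d × Fin d => (g : Matrix (Fin d) (Fin d) ℂ) ij.1 ij.2) p = 0

section LinearRepresentation

variable {d : ℕ}

/-- Reading the entries of an element of `SL_d(ℤ)` in a commutative ring `R`. -/
def matCast (R : Type*) [CommRing R] :
    Matrix.SpecialLinearGroup (Fin d) ℤ →* Matrix (Fin d) (Fin d) R :=
  (RingHom.toMonoidHom (Int.castRingHom R).mapMatrix).comp
    Matrix.SpecialLinearGroup.coeMonoidHom

theorem matCast_apply {R : Type*} [CommRing R] (a : Matrix.SpecialLinearGroup (Fin d) ℤ) :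
    matCast R a = (a : Matrix (Fin d) (Fin d) ℤ).map ((↑) : ℤ → R) := rfl

theorem exists_mem_spectrum_nnnorm_eq_spectralRadius [NeZero d] (A : Matrix (Fin d) (Fin d) ℂ) :
    ∃ μ ∈ spectrum ℂ A, spectralRadius ℂ A = (‖μ‖₊ : ENNReal) ∧
      ∀ ν ∈ spectrum ℂ A, ‖ν‖ ≤ ‖μ‖ := by
  obtain ⟨μ, hμ, hmax⟩ := Set.exists_max_image (spectrum ℂ A) (fun z => ‖z‖)
    (Matrix.finite_spectrum A)
    (spectrum.nonempty_of_isAlgClosed_of_finiteDimensional ℂ A)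
  refine ⟨μ, hμ, le_antisymm ?_ ?_, hmax⟩
  · exact iSup₂_le fun ν hν => by exact_mod_cast hmax ν hν
  · exact le_iSup₂ (f := fun (k : ℂ) (_ : k ∈ spectrum ℂ A) => (‖k‖₊ : ENNReal)) μ hμ

theorem exists_mem_spectrum_norm_eq_LamZ [NeZero d] (a : Matrix.SpecialLinearGroup (Fin d) ℤ) :
    ∃ μ ∈ spectrum ℂ ((a : Matrix (Fin d) (Fin d) ℤ).map ((↑) : ℤ → ℂ)), LamZ a = ‖μ‖ ∧
      ∀ ν ∈ spectrum ℂ ((a : Matrix (Fin d) (Fin d) ℤ).map ((↑) : ℤ → ℂ)), ‖ν‖ ≤ ‖μ‖ := by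
  obtain ⟨μ, hμ, h, hmax⟩ := exists_mem_spectrum_nnnorm_eq_spectralRadius
    ((a : Matrix (Fin d) (Fin d) ℤ).map ((↑) : ℤ → ℂ))
  exact ⟨μ, hμ, by simp [LamZ, h], hmax⟩

theorem norm_le_LamZ [NeZero d] (a : Matrix.SpecialLinearGroup (Fin d) ℤ) {ν : ℂ}
    (hν : ν ∈ spectrum ℂ ((a : Matrix (Fin d) (Fin d) ℤ).map ((↑) : ℤ → ℂ))) :
    ‖ν‖ ≤ LamZ a := by
  obtain ⟨μ, -, h, hmax⟩ := exists_mem_spectrum_norm_eq_LamZ a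
  exact h ▸ hmax ν hν

theorem LamZ_nonneg (a : Matrix.SpecialLinearGroup (Fin d) ℤ) : 0 ≤ LamZ a :=
  ENNReal.toReal_nonneg

theorem LamZ_pow_le [NeZero d] (a : Matrix.SpecialLinearGroup (Fin d) ℤ) (q : ℕ) :
    LamZ a ^ q ≤ LamZ (a ^ q) := by
  obtain ⟨μ, hμ, h, -⟩ := exists_mem_spectrum_norm_eq_LamZ a
  rw [h, ← norm_pow]
  apply norm_le_LamZ
  rw [← matCast_apply, map_pow]
  exact spectrum.pow_mem_pow _ q hμ

theorem LamZ_conj (h a : Matrix.SpecialLinearGroup (Fin d) ℤ) :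
    LamZ (h * a * h⁻¹) = LamZ a := by
  have h1 : matCast ℂ (h * a * h⁻¹) =
      ((matCast ℂ).toHomUnits h : Matrix (Fin d) (Fin d) ℂ) * matCast ℂ a *
        (((matCast ℂ).toHomUnits h)⁻¹ : (Matrix (Fin d) (Fin d) ℂ)ˣ) := by
    rw [← map_inv, MonoidHom.coe_toHomUnits, MonoidHom.coe_toHomUnits, map_mul, map_mul]
  unfold LamZ
  rw [← matCast_apply, ← matCast_apply, h1, spectralRadius, spectralRadius,
    spectrum.units_conjugate]

theorem abs_trace_le [NeZero d] (a : Matrix.SpecialLinearGroup (Fin d) ℤ) :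
    |((a : Matrix (Fin d) (Fin d) ℤ).trace : ℝ)| ≤ d * LamZ a := by
  set A := (a : Matrix (Fin d) (Fin d) ℤ).map ((↑) : ℤ → ℂ) with hA
  have h1 : (((a : Matrix (Fin d) (Fin d) ℤ).trace : ℤ) : ℂ) = A.charpoly.roots.sum := by
    rw [← Matrix.trace_eq_sum_roots_charpoly]
    simp [Matrix.trace, hA]
  have h2 : ‖A.charpoly.roots.sum‖ ≤ d * LamZ a := by
    refine (norm_multiset_sum_le _).trans ?_
    refine (Multiset.sum_le_card_nsmul _ (LamZ a) ?_).trans ?_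
    · intro x hx
      obtain ⟨ν, hν, rfl⟩ := Multiset.mem_map.1 hx
      exact norm_le_LamZ a (Matrix.mem_spectrum_iff_isRoot_charpoly.2
        (Polynomial.isRoot_of_mem_roots hν))
    · rw [nsmul_eq_mul]
      gcongr
      · exact LamZ_nonneg a
      · rw [Multiset.card_map]
        exact (Polynomial.card_roots' _).trans (by simp [Matrix.charpoly_natDegree_eq_dim])
  rw [← h1, Complex.norm_intCast] at h2
  exact h2

end LinearRepresentation

section Spanning

variable {d : ℕ}

theorem exists_finrank_lt_succ_of_monotone {V : Type*} [AddCommGroup V] [Module ℚ V]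
    [FiniteDimensional ℚ V] (W : ℕ → Submodule ℚ V) (hW : Monotone W) :
    ∃ k ≤ Module.finrank ℚ V, W k = W (k + 1) := by
  by_contra! h
  have key : ∀ k ≤ Module.finrank ℚ V + 1, k ≤ Module.finrank ℚ (W k) := by
    intro k
    induction k with
    | zero => simp
    | succ k ih =>
      intro hk
      have h1 := ih (by omega)
      have h2 := Submodule.finrank_lt_finrank_of_lt
        (lt_of_le_of_ne (hW (Nat.le_succ k)) (h k (by omega)))
      simp only [Nat.succ_eq_add_one] at h2
      omega
  have h1 := key _ le_rfl
  have h2 := Submodule.finrank_le (W (Module.finrank ℚ V + 1))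
  omega

theorem mul_mem_of_mem_closure (W : Submodule ℚ (Matrix (Fin d) (Fin d) ℚ))
    (S : Set (Matrix.SpecialLinearGroup (Fin d) ℤ))
    (hS : ∀ σ ∈ S, ∀ x ∈ W, matCast ℚ σ * x ∈ W) {g : Matrix.SpecialLinearGroup (Fin d) ℤ}
    (hg : g ∈ Subgroup.closure S) : ∀ x ∈ W, matCast ℚ g * x ∈ W := by
  induction hg using Subgroup.closure_induction with
  | mem σ hσ => exact hS σ hσ
  | one => simp
  | mul g h _ _ ihg ihh =>
    intro x hx
    rw [map_mul, mul_assoc]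
    exact ihg _ (ihh _ hx)
  | inv g _ ih =>
    have hinv : matCast ℚ g⁻¹ * matCast ℚ g = 1 := by rw [← map_mul, inv_mul_cancel, map_one]
    let f : W →ₗ[ℚ] W := (LinearMap.mulLeft ℚ (matCast ℚ g)).restrict ih
    have hf : Function.Injective f := by
      intro x y hxy
      have h1 : matCast ℚ g * (x : Matrix (Fin d) (Fin d) ℚ) = matCast ℚ g * y :=
        congrArg Subtype.val hxy
      have h2 := congrArg (matCast ℚ g⁻¹ * ·) h1
      simp only [← mul_assoc, hinv, one_mul] at h2
      exact Subtype.ext h2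
    intro x hx
    obtain ⟨y, hy⟩ := LinearMap.injective_iff_surjective.1 hf ⟨x, hx⟩
    have h1 : matCast ℚ g * (y : Matrix (Fin d) (Fin d) ℚ) = x := congrArg Subtype.val hy
    rw [← h1, ← mul_assoc, hinv, one_mul]
    exact y.2

theorem eq_top_of_zariskiDense (hd : 2 ≤ d) {Δ : Subgroup (Matrix.SpecialLinearGroup (Fin d) ℤ)}
    (hΔ : ZariskiDenseSLZ d Δ) (W : Submodule ℚ (Matrix (Fin d) (Fin d) ℚ))
    (hW : ∀ g ∈ Δ, matCast ℚ g ∈ W) : W = ⊤ := by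
  by_contra hne
  obtain ⟨f, hf0, hf⟩ := W.exists_le_ker_of_lt_top (lt_top_iff_ne_top.2 hne)
  have hfsum : ∀ x : Matrix (Fin d) (Fin d) ℚ,
      f x = ∑ ij : Fin d × Fin d, f (Matrix.single ij.1 ij.2 1) * x ij.1 ij.2 := by
    intro x
    conv_lhs => rw [Matrix.matrix_eq_sum_single x]
    rw [Fintype.sum_prod_type]
    simp only [map_sum]
    refine Finset.sum_congr rfl fun i _ => Finset.sum_congr rfl fun j _ => ?_
    have : Matrix.single i j (x i j) = x i j • Matrix.single i j (1 : ℚ) := by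
      rw [Matrix.smul_single, smul_eq_mul, mul_one]
    rw [this, map_smul, smul_eq_mul, mul_comm]
  let F : Matrix (Fin d) (Fin d) ℂ → ℂ := fun g =>
    ∑ ij : Fin d × Fin d, ((f (Matrix.single ij.1 ij.2 1) : ℚ) : ℂ) * g ij.1 ij.2
  have hF : ∀ g : Matrix.SpecialLinearGroup (Fin d) ℂ, F g = 0 := by
    intro g
    have := hΔ (∑ ij : Fin d × Fin d,
      MvPolynomial.C (f (Matrix.single ij.1 ij.2 1)) * MvPolynomial.X ij) ?_ g
    · simpa [F] using this
    · intro γ hγ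
      have h1 : f (matCast ℚ γ) = 0 := hf (hW γ hγ)
      rw [hfsum] at h1
      simpa [matCast_apply] using h1
  have hFadd : ∀ x y, F (x + y) = F x + F y := by
    intro x y
    simp [F, mul_add, Finset.sum_add_distrib]
  have hFsingle : ∀ i j, F (Matrix.single i j 1) = ((f (Matrix.single i j 1) : ℚ) : ℂ) := by
    intro i j
    simp only [F]
    rw [Finset.sum_eq_single (i, j)]
    · simp
    · rintro ⟨i', j'⟩ - hne
      rw [Matrix.single_apply_of_ne, mul_zero]
      rintro ⟨rfl, rfl⟩
      exact hne rfl
    · simp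
  have hoff : ∀ i j, i ≠ j → F (Matrix.single i j 1) = 0 := by
    intro i j hij
    have h1 := hF (Matrix.SpecialLinearGroup.transvection hij 1)
    have h0 := hF 1
    rw [Matrix.SpecialLinearGroup.transvection_coe, hFadd] at h1
    rw [Matrix.SpecialLinearGroup.coe_one] at h0
    rwa [h0, zero_add] at h1
  have hdiag : ∀ i, F (Matrix.single i i 1) = 0 := by
    intro i
    obtain ⟨j, hij⟩ : ∃ j : Fin d, i ≠ j := by
      have : Nontrivial (Fin d) := Fin.nontrivial_iff_two_le.2 hd
      obtain ⟨j, hj⟩ := exists_ne i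
      exact ⟨j, hj.symm⟩
    have h1 := hF (Matrix.SpecialLinearGroup.transvection hij 1 *
      Matrix.SpecialLinearGroup.transvection hij.symm 1)
    have h0 := hF 1
    rw [Matrix.SpecialLinearGroup.coe_one] at h0
    rw [Matrix.SpecialLinearGroup.coe_mul, Matrix.SpecialLinearGroup.transvection_coe,
      Matrix.SpecialLinearGroup.transvection_coe, add_mul, one_mul, mul_add, mul_one,
      Matrix.single_mul_single_same, mul_one, hFadd, hFadd, hFadd, h0, hoff i j hij,
      hoff j i hij.symm] at h1
    simpa using h1
  apply hf0
  refine LinearMap.ext fun x => ?_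
  rw [hfsum]
  refine Finset.sum_eq_zero fun ⟨i, j⟩ _ => ?_
  have h1 : F (Matrix.single i j 1) = 0 := by
    by_cases hij : i = j
    · exact hij ▸ hdiag i
    · exact hoff i j hij
  rw [hFsingle, Rat.cast_eq_zero] at h1
  rw [h1, zero_mul]

theorem span_pow_eq_top (hd : 2 ≤ d) {S : Set (Matrix.SpecialLinearGroup (Fin d) ℤ)}
    (h1 : 1 ∈ S) (hS : ZariskiDenseSLZ d (Subgroup.closure S)) :
    Submodule.span ℚ (matCast ℚ '' S ^ (d * d)) = ⊤ := by
  let W : ℕ → Submodule ℚ (Matrix (Fin d) (Fin d) ℚ) := fun k =>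
    Submodule.span ℚ (matCast ℚ '' S ^ k)
  have hW : Monotone W := fun k l hkl =>
    Submodule.span_mono (Set.image_mono (Set.pow_subset_pow_right h1 hkl))
  obtain ⟨k, hk, hkk⟩ := exists_finrank_lt_succ_of_monotone W hW
  have hrank : Module.finrank ℚ (Matrix (Fin d) (Fin d) ℚ) = d * d := by
    simp [Module.finrank_matrix]
  have hone : (1 : Matrix (Fin d) (Fin d) ℚ) ∈ W k :=
    Submodule.subset_span ⟨1, Set.one_mem_pow h1, map_one _⟩
  have hmul : ∀ σ ∈ S, ∀ x ∈ W k, matCast ℚ σ * x ∈ W k := by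
    intro σ hσ x hx
    rw [hkk]
    induction hx using Submodule.span_induction with
    | mem x hx =>
      obtain ⟨g, hg, rfl⟩ := hx
      refine Submodule.subset_span ⟨σ * g, ?_, map_mul _ _ _⟩
      rw [pow_succ']
      exact Set.mul_mem_mul hσ hg
    | zero => simp
    | add x y _ _ hx hy => rw [mul_add]; exact add_mem hx hy
    | smul c x _ hx => rw [mul_smul_comm]; exact Submodule.smul_mem _ _ hx
  have htop : W k = ⊤ := eq_top_of_zariskiDense hd hS _ fun g hg => by
    simpa using mul_mem_of_mem_closure (W k) S hmul hg 1 hone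
  exact top_le_iff.1 (htop ▸ hW (hk.trans hrank.le))

/-- A spanning family contains a basis, indexed by any type of the right cardinality. -/
theorem exists_linearIndependent_comp {ι κ V : Type*} [Fintype κ] [AddCommGroup V] [Module ℚ V]
    [FiniteDimensional ℚ V] (v : ι → V) (hv : Submodule.span ℚ (Set.range v) = ⊤)
    (hκ : Fintype.card κ = Module.finrank ℚ V) :
    ∃ s : κ → ι, LinearIndependent ℚ (v ∘ s) := by
  obtain ⟨κ', a, -, hspan, hli⟩ := exists_linearIndependent' ℚ v
  let b := Module.Basis.mk hli (by rw [hspan, hv])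
  have : Fintype κ' := FiniteDimensional.fintypeBasisIndex b
  have e : κ ≃ κ' := Fintype.equivOfCardEq (by rw [hκ, Module.finrank_eq_card_basis b])
  exact ⟨a ∘ e, hli.comp e e.injective⟩

theorem exists_linearIndependent_mem_pow (hd : 2 ≤ d)
    {S : Set (Matrix.SpecialLinearGroup (Fin d) ℤ)}
    (h1 : 1 ∈ S) (hS : ZariskiDenseSLZ d (Subgroup.closure S)) :
    ∃ a : Fin (d * d) → Matrix.SpecialLinearGroup (Fin d) ℤ, (∀ i, a i ∈ S ^ (d * d)) ∧
      LinearIndependent ℚ (fun i => matCast ℚ (a i)) := by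
  obtain ⟨s, hs⟩ := exists_linearIndependent_comp (κ := Fin (d * d))
    (fun g : ↥(S ^ (d * d)) => matCast ℚ (g : Matrix.SpecialLinearGroup (Fin d) ℤ))
    (by rw [← span_pow_eq_top hd h1 hS, Set.image_eq_range])
    (by simp [Module.finrank_matrix])
  exact ⟨fun i => s i, fun i => (s i).2, hs⟩

end Spanning

section TraceForm

variable {d : ℕ} {ι : Type*} [Fintype ι]

theorem eq_zero_of_trace_mul_eq_zero {a : ι → Matrix.SpecialLinearGroup (Fin d) ℤ}
    (ha : LinearIndependent ℚ fun i => matCast ℚ (a i)) (hι : Fintype.card ι = d * d)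
    (X : Matrix (Fin d) (Fin d) ℤ)
    (hX : ∀ i, ((a i : Matrix (Fin d) (Fin d) ℤ) * X).trace = 0) : X = 0 := by
  have hspan := ha.span_eq_top_of_card_eq_finrank' (by simp [Module.finrank_matrix, hι])
  let Y : Matrix (Fin d) (Fin d) ℚ := (Int.castRingHom ℚ).mapMatrix X
  have h1 : ∀ y : Matrix (Fin d) (Fin d) ℚ, (y * Y).trace = 0 := by
    intro y
    have hy : y ∈ Submodule.span ℚ (Set.range fun i => matCast ℚ (a i)) := hspan ▸ trivial
    induction hy using Submodule.span_induction with
    | mem y hy =>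
      obtain ⟨i, rfl⟩ := hy
      have h2 : matCast ℚ (a i) * Y = (Int.castRingHom ℚ).mapMatrix
          ((a i : Matrix (Fin d) (Fin d) ℤ) * X) := by
        rw [map_mul]; rfl
      have h3 := congrArg (Int.cast : ℤ → ℚ) (hX i)
      simp only [h2, RingHom.mapMatrix_apply]
      simpa [Matrix.trace] using h3
    | zero => simp
    | add x y _ _ hx hy => rw [add_mul, Matrix.trace_add, hx, hy, add_zero]
    | smul c x _ hx => rw [smul_mul_assoc, Matrix.trace_smul, hx, smul_zero]
  have h2 : Y = 0 := Matrix.ext_iff_trace_mul_left.2 fun x => by rw [h1, mul_zero, Matrix.trace_zero]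
  ext i j
  have h3 := congrFun (congrFun h2 i) j
  simpa [Y] using h3

/-- The Gram matrix of the trace form on a family of elements of `SL_d(ℤ)`. -/
def traceGram (a : ι → Matrix.SpecialLinearGroup (Fin d) ℤ) : Matrix ι ι ℤ :=
  Matrix.of fun i j => (a i * a j : Matrix (Fin d) (Fin d) ℤ).trace

theorem trace_mul_sum_eq_traceGram_mulVec (a : ι → Matrix.SpecialLinearGroup (Fin d) ℤ)
    (c : ι → ℤ) (i : ι) :
    ((a i : Matrix (Fin d) (Fin d) ℤ) * ∑ j, c j • (a j : Matrix (Fin d) (Fin d) ℤ)).trace =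
      (traceGram a).mulVec c i := by
  simp only [Finset.mul_sum, mul_smul_comm, Matrix.trace_sum, Matrix.trace_smul, Matrix.mulVec,
    dotProduct, traceGram, Matrix.of_apply, smul_eq_mul]
  exact Finset.sum_congr rfl fun j _ => mul_comm _ _

variable [DecidableEq ι]

theorem traceGram_det_ne_zero {a : ι → Matrix.SpecialLinearGroup (Fin d) ℤ}
    (ha : LinearIndependent ℚ fun i => matCast ℚ (a i)) (hι : Fintype.card ι = d * d) :
    (traceGram a).det ≠ 0 := by
  intro h0
  obtain ⟨c, hc, hTc⟩ := Matrix.exists_mulVec_eq_zero_iff.2 h0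
  have h1 : ∑ j, c j • (a j : Matrix (Fin d) (Fin d) ℤ) = 0 :=
    eq_zero_of_trace_mul_eq_zero ha hι _ fun i => by
      rw [trace_mul_sum_eq_traceGram_mulVec, hTc, Pi.zero_apply]
  apply hc
  have h2 : ∑ j, (c j : ℚ) • matCast ℚ (a j) = 0 := by
    have := congrArg (Int.castRingHom ℚ).mapMatrix h1
    rw [map_sum, map_zero] at this
    rw [← this]
    refine Finset.sum_congr rfl fun j _ => ?_
    rw [map_zsmul, ← Int.cast_smul_eq_zsmul ℚ]
    rfl
  funext j
  exact_mod_cast Fintype.linearIndependent_iff.1 ha _ h2 j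

theorem exists_coeff_le_of_trace_le {a : ι → Matrix.SpecialLinearGroup (Fin d) ℤ}
    (ha : LinearIndependent ℚ fun i => matCast ℚ (a i)) (hι : Fintype.card ι = d * d)
    {B : ℝ} (hB : ∀ i j, |(((a i * a j : Matrix (Fin d) (Fin d) ℤ).trace : ℤ) : ℝ)| ≤ B)
    (x : Matrix.SpecialLinearGroup (Fin d) ℤ)
    (hx : ∀ i, |(((a i * x : Matrix (Fin d) (Fin d) ℤ).trace : ℤ) : ℝ)| ≤ B) :
    ∃ c : ι → ℝ, matCast ℝ x = ∑ j, c j • matCast ℝ (a j) ∧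
      ∀ j, |c j| ≤ (d * d).factorial * B ^ (d * d) := by
  have hdet := traceGram_det_ne_zero ha hι
  set T := traceGram a with hT
  let t : ι → ℤ := fun i => (a i * x : Matrix (Fin d) (Fin d) ℤ).trace
  have h1 : ∑ j, T.cramer t j • (a j : Matrix (Fin d) (Fin d) ℤ) =
      T.det • (x : Matrix (Fin d) (Fin d) ℤ) := by
    rw [← sub_eq_zero]
    refine eq_zero_of_trace_mul_eq_zero ha hι _ fun i => ?_
    rw [mul_sub, Matrix.trace_sub, trace_mul_sum_eq_traceGram_mulVec, ← hT, Matrix.mulVec_cramer,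
      mul_smul_comm, Matrix.trace_smul]
    exact sub_self _
  have h2 : ∑ j, (T.cramer t j : ℝ) • matCast ℝ (a j) = (T.det : ℝ) • matCast ℝ x := by
    have := congrArg (Int.castRingHom ℝ).mapMatrix h1
    rw [map_sum, map_zsmul, ← Int.cast_smul_eq_zsmul ℝ] at this
    refine Eq.trans (Finset.sum_congr rfl fun j _ => ?_) this
    rw [map_zsmul, ← Int.cast_smul_eq_zsmul ℝ]
    rfl
  have hdetR : (T.det : ℝ) ≠ 0 := by exact_mod_cast hdet
  refine ⟨fun j => (T.det : ℝ)⁻¹ * T.cramer t j, ?_, fun j => ?_⟩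
  · simp_rw [mul_smul]
    rw [← Finset.smul_sum, h2, smul_smul, inv_mul_cancel₀ hdetR, one_smul]
  · have h3 : (1 : ℝ) ≤ |(T.det : ℝ)| := by exact_mod_cast Int.one_le_abs hdet
    have h4 : |(T.cramer t j : ℝ)| ≤ (d * d).factorial * B ^ (d * d) := by
      rw [Matrix.cramer_apply]
      have := Matrix.det_le (A := (Int.castRingHom ℝ).mapMatrix (T.updateCol j t))
        (abv := AbsoluteValue.abs) (x := B) (fun i k => ?_)
      · rw [← RingHom.map_det, hι, nsmul_eq_mul] at this
        exact this
      · by_cases hk : k = j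
        · subst hk
          simpa using hx i
        · rw [RingHom.mapMatrix_apply, Matrix.map_apply, Matrix.updateCol_ne hk]
          exact hB i k
    rw [abs_mul, abs_inv]
    calc |(T.det : ℝ)|⁻¹ * |(T.cramer t j : ℝ)| ≤ 1 * |(T.cramer t j : ℝ)| := by
          gcongr
          exact inv_le_one_of_one_le₀ h3
      _ ≤ _ := by rwa [one_mul]

end TraceForm

section OrbitFrames

variable {d : ℕ} {ι : Type*} [Fintype ι]

/-- The matrix whose `k`-th column is `a (s k)` applied to `e`. -/
def frame (a : ι → Matrix.SpecialLinearGroup (Fin d) ℤ) (e : Fin d → ℤ) (s : Fin d → ι) :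
    Matrix (Fin d) (Fin d) ℤ :=
  Matrix.of fun i k => (a (s k) : Matrix (Fin d) (Fin d) ℤ).mulVec e i

/-- The largest absolute value of a determinant of a frame in the orbit of `e`. -/
def frameVolume (a : ι → Matrix.SpecialLinearGroup (Fin d) ℤ) (e : Fin d → ℤ) : ℕ :=
  open Classical in Finset.univ.sup fun s : Fin d → ι => (frame a e s).det.natAbs

theorem natAbs_det_frame_le (a : ι → Matrix.SpecialLinearGroup (Fin d) ℤ) (e : Fin d → ℤ)
    (s : Fin d → ι) : (frame a e s).det.natAbs ≤ frameVolume a e := by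
  classical
  exact Finset.le_sup (f := fun s : Fin d → ι => (frame a e s).det.natAbs) (Finset.mem_univ s)

theorem exists_natAbs_det_frame_eq [Nonempty ι] (a : ι → Matrix.SpecialLinearGroup (Fin d) ℤ)
    (e : Fin d → ℤ) : ∃ s, (frame a e s).det.natAbs = frameVolume a e := by
  classical
  obtain ⟨s, -, hs⟩ := Finset.exists_mem_eq_sup Finset.univ Finset.univ_nonempty
    fun s : Fin d → ι => (frame a e s).det.natAbs
  exact ⟨s, hs.symm⟩

theorem frameVolume_pos {a : ι → Matrix.SpecialLinearGroup (Fin d) ℤ}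
    (ha : LinearIndependent ℚ fun i => matCast ℚ (a i)) (hι : Fintype.card ι = d * d)
    {e : Fin d → ℤ} (he : e ≠ 0) : 0 < frameVolume a e := by
  have hspan := ha.span_eq_top_of_card_eq_finrank' (by simp [Module.finrank_matrix, hι])
  let e' : Fin d → ℚ := fun i => e i
  let L : Matrix (Fin d) (Fin d) ℚ →ₗ[ℚ] Fin d → ℚ :=
    { toFun := fun x => x.mulVec e'
      map_add' := fun x y => Matrix.add_mulVec x y e'
      map_smul' := fun c x => Matrix.smul_mulVec c x e' }
  have hL : LinearMap.range L = ⊤ := by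
    rw [LinearMap.range_eq_top]
    intro z
    obtain ⟨i, hi⟩ := Function.ne_iff.1 he
    have hi' : e' i ≠ 0 := by simpa [e'] using hi
    refine ⟨Matrix.vecMulVec z (Pi.single i (e' i)⁻¹), ?_⟩
    change (Matrix.vecMulVec z (Pi.single i (e' i)⁻¹)).mulVec e' = z
    rw [Matrix.vecMulVec_mulVec, single_dotProduct, inv_mul_cancel₀ hi']
    simp
  obtain ⟨s, hs⟩ := exists_linearIndependent_comp (κ := Fin d)
    (fun j => L (matCast ℚ (a j)))
    (by rw [← hL, LinearMap.range_eq_map, ← hspan, Submodule.map_span, ← Set.range_comp]; rfl)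
    (by simp)
  refine lt_of_lt_of_le (Nat.pos_of_ne_zero ?_) (natAbs_det_frame_le a e s)
  rw [Int.natAbs_ne_zero]
  intro h0
  have hcol : ((Int.castRingHom ℚ).mapMatrix (frame a e s)).col =
      (fun j => L (matCast ℚ (a j))) ∘ s := by
    ext k i
    simp [frame, L, Matrix.mulVec, dotProduct, matCast_apply, Matrix.col, e']
  rw [← hcol, Matrix.linearIndependent_cols_iff_isUnit, Matrix.isUnit_iff_isUnit_det,
    ← RingHom.map_det, h0] at hs
  simp at hs

end OrbitFrames

section GeometryOfNumbers

variable {d : ℕ}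

open MeasureTheory in
theorem abs_det_mul_pow_le_one {V : Matrix (Fin d) (Fin d) ℝ} (hV : V.det ≠ 0) {δ : ℝ}
    (hδ : 0 < δ)
    (h : ∀ y : Fin d → ℤ, y ≠ 0 → ∃ k, δ ≤ |V⁻¹.mulVec (fun i => (y i : ℝ)) k|) :
    |V.det| * δ ^ d ≤ 1 := by
  by_contra! hlt
  have hV' : V⁻¹.det ≠ 0 := by
    rw [Matrix.det_nonsing_inv, Ring.inverse_eq_inv']
    exact inv_ne_zero hV
  let f : (Fin d → ℝ) →ₗ[ℝ] (Fin d → ℝ) := Matrix.toLin' V⁻¹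
  have hf : LinearMap.det f = V⁻¹.det := LinearMap.det_toLin' _
  let C : Set (Fin d → ℝ) := Set.univ.pi fun _ => Set.Ioo (-δ) δ
  have hvol : volume (f ⁻¹' C) = ENNReal.ofReal (|V.det| * (2 * δ) ^ d) := by
    rw [Measure.addHaar_preimage_linearMap _ (hf ▸ hV'), hf, Matrix.det_nonsing_inv,
      Ring.inverse_eq_inv', inv_inv, volume_pi_pi]
    simp only [Real.volume_Ioo, Finset.prod_const, Finset.card_univ, Fintype.card_fin]
    rw [ENNReal.ofReal_mul (abs_nonneg _), ENNReal.ofReal_pow (by positivity)]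
    congr 3
    ring
  have hfund : volume (ZSpan.fundamentalDomain (Pi.basisFun ℝ (Fin d))) = 1 := by
    rw [ZSpan.fundamentalDomain_pi_basisFun, volume_pi_pi]
    simp
  have : Countable (Submodule.span ℤ (Set.range (Pi.basisFun ℝ (Fin d)))).toAddSubgroup :=
    inferInstanceAs (Countable (Submodule.span ℤ (Set.range (Pi.basisFun ℝ (Fin d)))))
  obtain ⟨x, hx0, hx⟩ := exists_ne_zero_mem_lattice_of_measure_mul_two_pow_lt_measure
    (L := (Submodule.span ℤ (Set.range (Pi.basisFun ℝ (Fin d)))).toAddSubgroup)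
    (s := f ⁻¹' C)
    (ZSpan.isAddFundamentalDomain (Pi.basisFun ℝ (Fin d)) volume)
    (by
      intro x hx i _
      have := hx i trivial
      rw [map_neg, Pi.neg_apply]
      exact ⟨neg_lt_neg this.2, neg_lt.1 this.1⟩)
    ((convex_pi fun _ _ => convex_Ioo _ _).linear_preimage f)
    (by
      rw [hfund, hvol, one_mul, Module.finrank_fin_fun, mul_pow, ← ENNReal.ofReal_ofNat,
        ← ENNReal.ofReal_pow (by positivity)]
      refine (ENNReal.ofReal_lt_ofReal_iff (by positivity)).2 ?_
      nlinarith [pow_pos (two_pos : (0 : ℝ) < 2) d])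
  have hxmem : (x : Fin d → ℝ) ∈ Submodule.span ℤ (Set.range (Pi.basisFun ℝ (Fin d))) := x.2
  rw [Module.Basis.mem_span_iff_repr_mem] at hxmem
  choose y hy using hxmem
  have hy' : (fun i => (y i : ℝ)) = (x : Fin d → ℝ) := by
    ext i
    simpa using hy i
  obtain ⟨k, hk⟩ := h y (by
    rintro rfl
    apply hx0
    ext i
    rw [← hy']
    simp)
  have := hx k trivial
  rw [hy'] at hk
  exact absurd (abs_lt.2 this) (not_lt.2 hk)

end GeometryOfNumbers

section IntegralRowReduction

theorem exists_det_one_mulVec_eq_zero {ι : Type*} [Fintype ι] [DecidableEq ι] (i₀ : ι)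
    (c : ι → ℤ) : ∃ g : Matrix ι ι ℤ, g.det = 1 ∧ ∀ i, i ≠ i₀ → g.mulVec c i = 0 := by
  have htrans : ∀ (i j : ι) (t : ℤ) (c : ι → ℤ),
      (Matrix.transvection i j t).mulVec c = Function.update c i (c i + t * c j) := by
    intro i j t c
    ext k
    rw [Matrix.transvection, Matrix.add_mulVec, Matrix.one_mulVec, Matrix.single_mulVec]
    by_cases hk : k = i
    · subst hk; simp
    · simp [hk]
  induction hn : ∑ i, (c i).natAbs using Nat.strong_induction_on generalizing c with
  | _ n ih =>
    by_cases h : ∃ i j, i ≠ j ∧ c i ≠ 0 ∧ c j ≠ 0 ∧ (c i).natAbs ≤ (c j).natAbs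
    · obtain ⟨i, j, hij, hi, hj, hle⟩ := h
      let c' := Function.update c j (c j + -(c j / c i) * c i)
      have hc'j : c' j = c j % c i := by
        simp only [c', Function.update_self]
        rw [Int.emod_def]
        ring
      obtain ⟨g, hg, hg0⟩ := ih (∑ k, (c' k).natAbs) (by
        rw [← hn]
        refine Finset.sum_lt_sum (fun k _ => ?_) ⟨j, Finset.mem_univ _, ?_⟩
        · by_cases hk : k = j
          · subst hk
            rw [hc'j]
            have h1 := Int.abs_eq_natAbs (c i) ▸ Int.emod_lt_abs (c k) hi
            have h2 := Int.emod_nonneg (c k) hi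
            omega
          · simp [c', hk]
        · rw [hc'j]
          have h1 := Int.abs_eq_natAbs (c i) ▸ Int.emod_lt_abs (c j) hi
          have h2 := Int.emod_nonneg (c j) hi
          omega) c' rfl
      refine ⟨g * Matrix.transvection j i (-(c j / c i)), ?_, fun k hk => ?_⟩
      · rw [Matrix.det_mul, hg, Matrix.det_transvection_of_ne _ _ hij.symm, one_mul]
      · rw [← Matrix.mulVec_mulVec, htrans]
        exact hg0 k hk
    · push Not at h
      have huniq : ∀ i j, c i ≠ 0 → c j ≠ 0 → i = j := by
        intro i j hi hj
        by_contra hij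
        have h1 := h i j hij hi hj
        have h2 := h j i (Ne.symm hij) hj hi
        omega
      by_cases hall : ∀ i, i ≠ i₀ → c i = 0
      · exact ⟨1, Matrix.det_one, fun i hi => by rw [Matrix.one_mulVec, hall i hi]⟩
      · push Not at hall
        obtain ⟨i, hi, hci⟩ := hall
        refine ⟨Matrix.transvection i i₀ (-1) * Matrix.transvection i₀ i 1, ?_, fun k hk => ?_⟩
        · rw [Matrix.det_mul, Matrix.det_transvection_of_ne _ _ hi,
            Matrix.det_transvection_of_ne _ _ hi.symm, one_mul]
        · have h0 : c i₀ = 0 := by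
            by_contra h0
            exact hi (huniq i i₀ hci h0)
          rw [← Matrix.mulVec_mulVec, htrans, htrans]
          by_cases hki : k = i
          · subst hki
            simp [hk, h0]
          · rw [Function.update_of_ne hki, Function.update_of_ne hk]
            by_contra hck
            exact hki (huniq k i hck hci)

/-- A weak form of the Hermite normal form. -/
def HasBoundedRowReduction (ι : Type*) [Fintype ι] [DecidableEq ι] : Prop :=
  ∀ V : Matrix ι ι ℤ, V.det ≠ 0 → ∃ g : Matrix ι ι ℤ, g.det = 1 ∧
    ∀ i j, |(g * V) i j| ≤ (Fintype.card ι).factorial * |V.det|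

theorem HasBoundedRowReduction.of_equiv {ι κ : Type*} [Fintype ι] [DecidableEq ι] [Fintype κ]
    [DecidableEq κ] (e : ι ≃ κ) (h : HasBoundedRowReduction ι) : HasBoundedRowReduction κ := by
  intro V hV
  obtain ⟨g, hg, hgV⟩ := h (V.submatrix e e) (by rwa [Matrix.det_submatrix_equiv_self])
  refine ⟨g.submatrix e.symm e.symm, by rwa [Matrix.det_submatrix_equiv_self], fun i j => ?_⟩
  have h1 := hgV (e.symm i) (e.symm j)
  rw [Matrix.det_submatrix_equiv_self, Fintype.card_congr e] at h1
  have h2 : g.submatrix e.symm e.symm * V = (g * V.submatrix e e).submatrix e.symm e.symm := by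
    rw [← Matrix.submatrix_mul_equiv _ _ _ e.symm, Matrix.submatrix_submatrix]
    simp
  rw [h2]
  exact h1

theorem exists_abs_add_mul_le {ι : Type*} [Fintype ι] [DecidableEq ι] {W : Matrix ι ι ℤ}
    (hW : W.det ≠ 0) {b : ℤ} (hb : ∀ i j, |W i j| ≤ b) (r : Matrix Unit ι ℤ) :
    ∃ z : Matrix Unit ι ℤ, ∀ i j, |(r + z * W) i j| ≤ Fintype.card ι * b := by
  let q : Matrix Unit ι ℤ := r * W.adjugate
  have hq : q * W = W.det • r := by
    rw [Matrix.mul_assoc, Matrix.adjugate_mul, Matrix.mul_smul, Matrix.mul_one]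
  let z : Matrix Unit ι ℤ := Matrix.of fun i k => -(q i k / W.det)
  refine ⟨z, fun i j => ?_⟩
  have h1 : W.det * (r + z * W) i j = ∑ k, (q i k % W.det) * W k j := by
    have h2 : W.det * r i j = ∑ k, q i k * W k j := by
      rw [← Matrix.mul_apply, hq, Matrix.smul_apply, smul_eq_mul]
    rw [Matrix.add_apply, mul_add, h2, Matrix.mul_apply, Finset.mul_sum, ← Finset.sum_add_distrib]
    refine Finset.sum_congr rfl fun k _ => ?_
    rw [Int.emod_def]
    simp only [z, Matrix.of_apply]
    ring
  have h3 : |W.det| * |(r + z * W) i j| ≤ |W.det| * (Fintype.card ι * b) := by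
    rw [← abs_mul, h1]
    calc |∑ k, (q i k % W.det) * W k j| ≤ ∑ k, |(q i k % W.det) * W k j| :=
          Finset.abs_sum_le_sum_abs _ _
      _ ≤ ∑ _k : ι, |W.det| * b := by
          refine Finset.sum_le_sum fun k _ => ?_
          rw [abs_mul]
          have h4 := Int.emod_lt_abs (q i k) hW
          have h5 := Int.emod_nonneg (q i k) hW
          rw [abs_of_nonneg h5]
          exact mul_le_mul h4.le (hb k j) (abs_nonneg _) (abs_nonneg _)
      _ = _ := by
          simp only [Finset.sum_const, Finset.card_univ, nsmul_eq_mul]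
          ring
  exact le_of_mul_le_mul_left h3 (abs_pos.2 hW)

theorem HasBoundedRowReduction.unit_sum {ι : Type*} [Fintype ι] [DecidableEq ι]
    (h : HasBoundedRowReduction ι) : HasBoundedRowReduction (Unit ⊕ ι) := by
  intro V hV
  obtain ⟨g₁, hg₁, hcol⟩ := exists_det_one_mulVec_eq_zero (Sum.inl () : Unit ⊕ ι)
    fun i => V i (Sum.inl ())
  set U := g₁ * V with hU
  have hUdet : U.det = V.det := by rw [hU, Matrix.det_mul, hg₁, one_mul]
  have hU21 : U.toBlocks₂₁ = 0 := by
    ext i j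
    exact hcol (Sum.inr i) (by simp)
  have hUblocks : U = Matrix.fromBlocks U.toBlocks₁₁ U.toBlocks₁₂ 0 U.toBlocks₂₂ := by
    rw [← hU21, Matrix.fromBlocks_toBlocks]
  have hdet : V.det = U.toBlocks₁₁.det * U.toBlocks₂₂.det := by
    rw [← hUdet, ← Matrix.det_fromBlocks_zero₂₁ _ U.toBlocks₁₂, ← hUblocks]
  have h₁ : U.toBlocks₁₁.det ≠ 0 := fun h0 => hV (by rw [hdet, h0, zero_mul])
  have h₂ : U.toBlocks₂₂.det ≠ 0 := fun h0 => hV (by rw [hdet, h0, mul_zero])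
  obtain ⟨g₂, hg₂, hbound⟩ := h _ h₂
  have hle₁ : |U.toBlocks₁₁.det| ≤ |V.det| := by
    rw [hdet, abs_mul]
    exact le_mul_of_one_le_right (abs_nonneg _) (Int.one_le_abs h₂)
  have hle₂ : |U.toBlocks₂₂.det| ≤ |V.det| := by
    rw [hdet, abs_mul]
    exact le_mul_of_one_le_left (abs_nonneg _) (Int.one_le_abs h₁)
  have hbound' : ∀ i j, |(g₂ * U.toBlocks₂₂) i j| ≤ (Fintype.card ι).factorial * |V.det| :=
    fun i j => (hbound i j).trans (by gcongr)
  obtain ⟨z, hz⟩ := exists_abs_add_mul_le (W := g₂ * U.toBlocks₂₂)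
    (by rwa [Matrix.det_mul, hg₂, one_mul]) hbound' U.toBlocks₁₂
  have hcard : Fintype.card (Unit ⊕ ι) = Fintype.card ι + 1 := by
    rw [Fintype.card_sum, Fintype.card_unit, add_comm]
  have hfac : ((Fintype.card (Unit ⊕ ι)).factorial : ℤ) =
      (Fintype.card ι + 1) * (Fintype.card ι).factorial := by
    rw [hcard, Nat.factorial_succ]
    push_cast
    ring
  have hpos : (1 : ℤ) ≤ (Fintype.card ι).factorial := by
    exact_mod_cast Nat.one_le_iff_ne_zero.2 (Nat.factorial_ne_zero _)
  have hcard0 : (0 : ℤ) ≤ Fintype.card ι := Int.natCast_nonneg _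
  have hf0 : 0 ≤ (Fintype.card ι : ℤ) * ((Fintype.card ι).factorial * |V.det|) := by positivity
  have hf1 : |V.det| ≤ (Fintype.card ι).factorial * |V.det| :=
    le_mul_of_one_le_left (abs_nonneg _) hpos
  refine ⟨Matrix.fromBlocks 1 (z * g₂) 0 g₂ * g₁, ?_, ?_⟩
  · rw [Matrix.det_mul, Matrix.det_fromBlocks_zero₂₁, Matrix.det_one, hg₁, hg₂, one_mul, one_mul]
  · rw [Matrix.mul_assoc, ← hU, hUblocks, Matrix.fromBlocks_multiply, hfac]
    rintro (i | i) (j | j)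
    · have h1 : |U.toBlocks₁₁ i j| ≤ |V.det| := by
        rw [Matrix.det_unique] at hle₁
        exact hle₁
      simp only [Matrix.fromBlocks_apply₁₁, Matrix.one_mul, Matrix.mul_zero, add_zero]
      linarith
    · have h1 := hz i j
      rw [← Matrix.mul_assoc] at h1
      simp only [Matrix.fromBlocks_apply₁₂, Matrix.one_mul]
      linarith [abs_nonneg V.det]
    · simp only [Matrix.fromBlocks_apply₂₁, Matrix.zero_mul, Matrix.mul_zero, add_zero,
        Matrix.zero_apply, abs_zero]
      positivity
    · have h1 := hbound' i j
      simp only [Matrix.fromBlocks_apply₂₂, Matrix.zero_mul, zero_add]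
      linarith

theorem hasBoundedRowReduction_fin (n : ℕ) : HasBoundedRowReduction (Fin n) := by
  induction n with
  | zero => exact fun V _ => ⟨1, Matrix.det_one, fun i => i.elim0⟩
  | succ n ih =>
    exact ih.unit_sum.of_equiv (Fintype.equivOfCardEq (by simp [add_comm]))

end IntegralRowReduction

section EntryBounds

variable {d : ℕ}

theorem abs_mul_apply_le {A B : Matrix (Fin d) (Fin d) ℝ} {x y : ℝ} (hA : ∀ i j, |A i j| ≤ x)
    (hB : ∀ i j, |B i j| ≤ y) (i j : Fin d) : |(A * B) i j| ≤ d * (x * y) := by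
  rw [Matrix.mul_apply]
  calc |∑ k, A i k * B k j| ≤ ∑ k, |A i k * B k j| := Finset.abs_sum_le_sum_abs _ _
    _ ≤ ∑ _k : Fin d, x * y := by
        refine Finset.sum_le_sum fun k _ => ?_
        rw [abs_mul]
        exact mul_le_mul (hA i k) (hB k j) (abs_nonneg _) ((abs_nonneg _).trans (hA i k))
    _ = d * (x * y) := by simp

theorem abs_mulVec_apply_le {A : Matrix (Fin d) (Fin d) ℝ} {v : Fin d → ℝ} {x y : ℝ}
    (hA : ∀ i j, |A i j| ≤ x) (hv : ∀ i, |v i| ≤ y) (i : Fin d) :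
    |A.mulVec v i| ≤ d * (x * y) := by
  calc |∑ k, A i k * v k| ≤ ∑ k, |A i k * v k| := Finset.abs_sum_le_sum_abs _ _
    _ ≤ ∑ _k : Fin d, x * y := by
        refine Finset.sum_le_sum fun k _ => ?_
        rw [abs_mul]
        exact mul_le_mul (hA i k) (hv k) (abs_nonneg _) ((abs_nonneg _).trans (hA i k))
    _ = d * (x * y) := by simp

theorem abs_det_le {A : Matrix (Fin d) (Fin d) ℝ} {x : ℝ} (hA : ∀ i j, |A i j| ≤ x) :
    |A.det| ≤ d.factorial * x ^ d := by
  have := Matrix.det_le (abv := AbsoluteValue.abs) hA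
  rwa [Fintype.card_fin, nsmul_eq_mul] at this

theorem abs_adjugate_apply_le {A : Matrix (Fin d) (Fin d) ℝ} {x : ℝ} (hx : 1 ≤ x)
    (hA : ∀ i j, |A i j| ≤ x) (i j : Fin d) : |A.adjugate i j| ≤ d.factorial * x ^ d := by
  rw [Matrix.adjugate_apply]
  refine abs_det_le fun k l => ?_
  by_cases hk : k = j
  · subst hk
    rw [Matrix.updateRow_self]
    by_cases hl : l = i
    · subst hl
      simpa using hx
    · simpa [Pi.single_apply, hl] using zero_le_one.trans hx
  · rw [Matrix.updateRow_ne hk]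
    exact hA k l

end EntryBounds

section BoundedConjugate

variable {d : ℕ}

/-- A bound for the matrix coefficients, in a suitable frame of an orbit, of elements whose
coefficients for left multiplication are at most `C`. -/
noncomputable def frameBound (d : ℕ) (C : ℝ) : ℝ := (d * d : ℕ) * C

/-- A bound for the index in `ℤ^d` of the lattice spanned by a minimal frame. -/
noncomputable def indexBound (d : ℕ) (C : ℝ) : ℝ :=
  (2 * d.factorial * (d * frameBound d C)) ^ d

/-- A bound for the entries of a frame after row reduction. -/
noncomputable def reducedBound (d : ℕ) (C : ℝ) : ℝ := d.factorial * indexBound d C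

/-- A bound for the entries after conjugation by an element of `SL_d(ℤ)`. -/
noncomputable def conjBound (d : ℕ) (C : ℝ) : ℝ :=
  d * ((d * (reducedBound d C * frameBound d C)) * (d.factorial * reducedBound d C ^ d))

variable {ι : Type*}

theorem map_frame_col (a : ι → Matrix.SpecialLinearGroup (Fin d) ℤ) (e : Fin d → ℤ)
    (s : Fin d → ι) (k : Fin d) :
    ((frame a e s).map ((↑) : ℤ → ℝ)).col k =
      (matCast ℝ (a (s k))).mulVec (fun i => (e i : ℝ)) := by
  ext i
  simp [frame, Matrix.mulVec, dotProduct, matCast_apply, Matrix.col]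

/-- The vectors of an orbit have coordinates at most one in a frame of maximal volume. -/
theorem abs_inv_frame_mulVec_le {a : ι → Matrix.SpecialLinearGroup (Fin d) ℤ}
    {e : Fin d → ℤ} {s : Fin d → ι} (hs : (frame a e s).det ≠ 0)
    (hmax : ∀ s', |(frame a e s').det| ≤ |(frame a e s).det|) (j : ι) (k : Fin d) :
    |(((frame a e s).map ((↑) : ℤ → ℝ))⁻¹.mulVec
      ((matCast ℝ (a j)).mulVec fun i => (e i : ℝ))) k| ≤ 1 := by
  set V := frame a e s with hV
  set VR := V.map ((↑) : ℤ → ℝ) with hVR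
  have hdet : VR.det = (V.det : ℝ) := (RingHom.map_det (Int.castRingHom ℝ) V).symm
  have hdet0 : VR.det ≠ 0 := by rw [hdet]; exact_mod_cast hs
  set u : Fin d → ℝ := (matCast ℝ (a j)).mulVec fun i => (e i : ℝ) with hu
  have h1 : VR⁻¹.mulVec u = VR.det⁻¹ • VR.cramer u := by
    rw [Matrix.inv_def, Ring.inverse_eq_inv', Matrix.smul_mulVec, Matrix.cramer_eq_adjugate_mulVec]
  have h2 : VR.cramer u k = ((frame a e (Function.update s k j)).det : ℝ) := by
    rw [Matrix.cramer_apply, ← eq_intCast (Int.castRingHom ℝ), RingHom.map_det]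
    congr 1
    ext i l
    by_cases hl : l = k
    · subst hl
      rw [Matrix.updateCol_self, hu]
      simp [frame, Matrix.mulVec, dotProduct, matCast_apply]
    · rw [Matrix.updateCol_ne hl]
      simp [hVR, hV, frame, hl]
  rw [h1, Pi.smul_apply, smul_eq_mul, h2, abs_mul, abs_inv, hdet, inv_mul_le_one₀]
  · exact_mod_cast hmax _
  · exact abs_pos.2 (by exact_mod_cast hs)

variable [Fintype ι]

theorem exists_minimal_frame [Nonempty ι] [NeZero d]
    {a : ι → Matrix.SpecialLinearGroup (Fin d) ℤ}
    (ha : LinearIndependent ℚ fun i => matCast ℚ (a i)) (hι : Fintype.card ι = d * d) :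
    ∃ (e : Fin d → ℤ) (s : Fin d → ι), (frame a e s).det ≠ 0 ∧
      (∀ s', |(frame a e s').det| ≤ |(frame a e s).det|) ∧
      ∀ y, y ≠ 0 → ∃ s', |(frame a e s).det| ≤ |(frame a y s').det| := by
  have hne : {e : Fin d → ℤ | e ≠ 0}.Nonempty :=
    ⟨fun _ => 1, fun h => one_ne_zero (congrFun h 0)⟩
  obtain ⟨e, he, hmin⟩ := (measure (frameVolume a)).wf.has_min _ hne
  obtain ⟨s, hs⟩ := exists_natAbs_det_frame_eq a e
  refine ⟨e, s, ?_, fun s' => ?_, fun y hy => ?_⟩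
  · rw [← Int.natAbs_ne_zero, hs]
    exact (frameVolume_pos ha hι he).ne'
  · have := natAbs_det_frame_le a e s'
    rw [← hs] at this
    rw [Int.abs_eq_natAbs, Int.abs_eq_natAbs]
    exact_mod_cast this
  · obtain ⟨s', hs'⟩ := exists_natAbs_det_frame_eq a y
    have : frameVolume a e ≤ frameVolume a y := not_lt.1 (hmin y hy)
    rw [← hs, ← hs'] at this
    refine ⟨s', ?_⟩
    rw [Int.abs_eq_natAbs, Int.abs_eq_natAbs]
    exact_mod_cast this

theorem exists_conj_le {a : ι → Matrix.SpecialLinearGroup (Fin d) ℤ} [Nonempty ι] [NeZero d]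
    (ha : LinearIndependent ℚ fun i => matCast ℚ (a i)) (hι : Fintype.card ι = d * d)
    {X : Set (Matrix.SpecialLinearGroup (Fin d) ℤ)} (haX : ∀ i, a i ∈ X) {C : ℝ} (hC : 0 < C)
    (hX : ∀ x ∈ X, ∀ i, ∃ c : ι → ℝ, matCast ℝ (x * a i) = ∑ j, c j • matCast ℝ (a j) ∧
      ∀ j, |c j| ≤ C) :
    ∃ h : Matrix.SpecialLinearGroup (Fin d) ℤ, ∀ x ∈ X, ∀ i j,
      |matCast ℝ (h * x * h⁻¹) i j| ≤ conjBound d C := by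
  obtain ⟨e, s, hdet, hmax, hmin⟩ := exists_minimal_frame ha hι
  set V := frame a e s with hV
  set VR := V.map ((↑) : ℤ → ℝ) with hVR
  have hdetR : VR.det = (V.det : ℝ) := (RingHom.map_det (Int.castRingHom ℝ) V).symm
  have hdet0 : VR.det ≠ 0 := by rw [hdetR]; exact_mod_cast hdet
  have hunit : IsUnit VR.det := isUnit_iff_ne_zero.2 hdet0
  have hD1 : 1 ≤ |VR.det| := by rw [hdetR]; exact_mod_cast Int.one_le_abs hdet
  have hd0 : (0 : ℝ) < d := by exact_mod_cast Nat.pos_of_ne_zero (NeZero.ne d)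
  have hfac : (1 : ℝ) ≤ d.factorial := by
    exact_mod_cast Nat.one_le_iff_ne_zero.2 (Nat.factorial_ne_zero d)
  have hC1 : 0 < frameBound d C := by unfold frameBound; push_cast; positivity
  have hframe : ∀ x ∈ X, ∀ l k, |(VR⁻¹ * matCast ℝ x * VR) l k| ≤ frameBound d C := by
    intro x hx l k
    obtain ⟨c, hc, hcC⟩ := hX x hx (s k)
    have h1 : (VR⁻¹ * matCast ℝ x * VR) l k =
        ∑ j, c j * (VR⁻¹.mulVec ((matCast ℝ (a j)).mulVec fun i => (e i : ℝ))) l := by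
      have h2 : (VR⁻¹ * matCast ℝ x * VR) l k =
          (VR⁻¹.mulVec ((matCast ℝ (x * a (s k))).mulVec fun i => (e i : ℝ))) l := by
        rw [map_mul, ← Matrix.mulVec_mulVec, ← map_frame_col a e s k, Matrix.mulVec_mulVec]
        rfl
      rw [h2, hc, Matrix.sum_mulVec, Matrix.mulVec_sum, Finset.sum_apply]
      refine Finset.sum_congr rfl fun j _ => ?_
      rw [Matrix.smul_mulVec, Matrix.mulVec_smul, Pi.smul_apply, smul_eq_mul]
    rw [h1]
    calc _ ≤ ∑ j, |c j * (VR⁻¹.mulVec ((matCast ℝ (a j)).mulVec fun i => (e i : ℝ))) l| :=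
          Finset.abs_sum_le_sum_abs _ _
      _ ≤ ∑ _j : ι, C * 1 := by
          refine Finset.sum_le_sum fun j _ => ?_
          rw [abs_mul]
          exact mul_le_mul (hcC j) (abs_inv_frame_mulVec_le hdet hmax j l) (abs_nonneg _) hC.le
      _ = frameBound d C := by simp [frameBound, hι]
  set M : ℝ := 2 * d.factorial * (d * frameBound d C) with hM
  have hM0 : 0 < M := by positivity
  have hlat : ∀ y : Fin d → ℤ, y ≠ 0 → ∃ k, M⁻¹ ≤ |VR⁻¹.mulVec (fun i => (y i : ℝ)) k| := by
    intro y hy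
    by_contra! hlt
    obtain ⟨s', hs'⟩ := hmin y hy
    set t := VR⁻¹.mulVec (fun i => (y i : ℝ)) with ht
    let P : Matrix (Fin d) (Fin d) ℝ :=
      Matrix.of fun i k => (VR⁻¹ * matCast ℝ (a (s' k)) * VR).mulVec t i
    have hP : ∀ i k, |P i k| ≤ d * (frameBound d C * M⁻¹) := fun i k =>
      abs_mulVec_apply_le (hframe _ (haX _)) (fun l => (hlt l).le) i
    have hVP : (frame a y s').map ((↑) : ℤ → ℝ) = VR * P := by
      refine Matrix.ext_col fun k => ?_
      have h1 : (VR * P).col k = VR.mulVec ((VR⁻¹ * matCast ℝ (a (s' k)) * VR).mulVec t) := rfl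
      rw [h1, map_frame_col, ht, Matrix.mulVec_mulVec, Matrix.mulVec_mulVec]
      congr 1
      rw [Matrix.mul_assoc, Matrix.mul_assoc, Matrix.mul_nonsing_inv _ hunit, Matrix.mul_one,
        ← Matrix.mul_assoc, Matrix.mul_nonsing_inv _ hunit, Matrix.one_mul]
    have h2 : |VR.det| ≤ |VR.det| * |P.det| := by
      rw [← abs_mul, ← Matrix.det_mul, ← hVP, hdetR]
      have h3 : ((frame a y s').map ((↑) : ℤ → ℝ)).det = ((frame a y s').det : ℝ) :=
        (RingHom.map_det (Int.castRingHom ℝ) _).symm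
      rw [h3]
      exact_mod_cast hs'
    have h4 : 1 ≤ |P.det| := by
      by_contra! h5
      nlinarith
    have h6 : d * (frameBound d C * M⁻¹) = (2 * (d.factorial : ℝ))⁻¹ := by
      rw [hM]
      field_simp
    have h7 : ((2 * (d.factorial : ℝ))⁻¹) ^ d ≤ (2 * (d.factorial : ℝ))⁻¹ :=
      pow_le_of_le_one (by positivity) (inv_le_one_of_one_le₀ (by linarith)) (NeZero.ne d)
    have h8 : |P.det| ≤ 1 / 2 := by
      calc |P.det| ≤ d.factorial * (d * (frameBound d C * M⁻¹)) ^ d := abs_det_le hP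
        _ ≤ d.factorial * (2 * (d.factorial : ℝ))⁻¹ := by
            rw [h6]
            gcongr
        _ = 1 / 2 := by field_simp
    linarith
  have hD : |VR.det| ≤ indexBound d C := by
    have h1 := abs_det_mul_pow_le_one hdet0 (inv_pos.2 hM0) hlat
    rw [inv_pow, ← div_eq_mul_inv, div_le_one (by positivity)] at h1
    exact h1
  obtain ⟨g, hg, hgV⟩ := hasBoundedRowReduction_fin d V hdet
  let h : Matrix.SpecialLinearGroup (Fin d) ℤ := ⟨g, hg⟩
  set U : Matrix (Fin d) (Fin d) ℝ := matCast ℝ h * VR with hU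
  have hUle : ∀ i j, |U i j| ≤ reducedBound d C := by
    intro i j
    have h1 : U = (g * V).map ((↑) : ℤ → ℝ) :=
      (map_mul (Int.castRingHom ℝ).mapMatrix g V).symm
    have h2 : |(((g * V) i j : ℤ) : ℝ)| ≤ d.factorial * |VR.det| := by
      have := hgV i j
      rw [Fintype.card_fin] at this
      rw [hdetR]
      exact_mod_cast this
    rw [h1, Matrix.map_apply]
    exact h2.trans (by unfold reducedBound; gcongr)
  have hred : 1 ≤ reducedBound d C :=
    one_le_mul_of_one_le_of_one_le hfac (hD1.trans hD)
  have hUdet : |U.det| = |VR.det| := by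
    have h1 : (matCast ℝ h).det = 1 := by
      have := (RingHom.map_det (Int.castRingHom ℝ) g).symm
      rw [hg, map_one] at this
      exact this
    rw [hU, Matrix.det_mul, h1, one_mul]
  have hUunit : IsUnit U.det := by
    rw [isUnit_iff_ne_zero, ← abs_pos, hUdet]
    linarith
  have hUinv : ∀ i j, |U⁻¹ i j| ≤ d.factorial * reducedBound d C ^ d := by
    intro i j
    rw [Matrix.inv_def, Ring.inverse_eq_inv', Matrix.smul_apply, smul_eq_mul, abs_mul, abs_inv,
      hUdet]
    calc _ ≤ 1 * |U.adjugate i j| := by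
          gcongr
          exact inv_le_one_of_one_le₀ hD1
      _ ≤ _ := by
          rw [one_mul]
          exact abs_adjugate_apply_le hred hUle i j
  refine ⟨h, fun x hx i j => ?_⟩
  have hconj : matCast ℝ (h * x * h⁻¹) = U * (VR⁻¹ * matCast ℝ x * VR) * U⁻¹ := by
    have h1 : matCast ℝ h * matCast ℝ h⁻¹ = 1 := by rw [← map_mul, mul_inv_cancel, map_one]
    have h2 : matCast ℝ (h * x * h⁻¹) * U = U * (VR⁻¹ * matCast ℝ x * VR) := by
      have h3 : matCast ℝ h⁻¹ * matCast ℝ h = 1 := by rw [← map_mul, inv_mul_cancel, map_one]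
      calc matCast ℝ (h * x * h⁻¹) * U
          = matCast ℝ h * matCast ℝ x * (matCast ℝ h⁻¹ * matCast ℝ h) * VR := by
            rw [map_mul, map_mul, hU]
            simp only [Matrix.mul_assoc]
        _ = matCast ℝ h * (VR * VR⁻¹) * matCast ℝ x * VR := by
            rw [h3, Matrix.mul_nonsing_inv _ hunit]
            simp only [Matrix.mul_one]
        _ = _ := by
            rw [hU]
            simp only [Matrix.mul_assoc]
    rw [← h2, Matrix.mul_assoc, Matrix.mul_nonsing_inv _ hUunit, Matrix.mul_one]
  rw [hconj]
  exact abs_mul_apply_le (abs_mul_apply_le hUle (hframe x hx)) hUinv i j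

end BoundedConjugate

section UniformEstimates

variable {d : ℕ}

theorem opNormR_le {A : Matrix (Fin d) (Fin d) ℝ} {x : ℝ} (hx : 0 ≤ x)
    (hA : ∀ i j, |A i j| ≤ x) : opNormR A ≤ d * d * x := by
  refine ContinuousLinearMap.opNorm_le_bound _ (by positivity) fun v => ?_
  have h1 : ∀ i, |A.mulVec v.ofLp i| ≤ d * (x * ‖v‖) :=
    abs_mulVec_apply_le hA fun i => by simpa using PiLp.norm_apply_le v i
  have h2 : ‖Matrix.toEuclideanLin A v‖ ≤ d * (d * (x * ‖v‖)) := by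
    rw [EuclideanSpace.norm_eq]
    refine Real.sqrt_le_iff.2 ⟨by positivity, ?_⟩
    calc ∑ i, ‖(Matrix.toEuclideanLin A v).ofLp i‖ ^ 2
        ≤ ∑ _i : Fin d, (d * (x * ‖v‖)) ^ 2 := by
          refine Finset.sum_le_sum fun i _ => ?_
          gcongr
          exact h1 i
      _ = d * (d * (x * ‖v‖)) ^ 2 := by simp
      _ ≤ (d * (d * (x * ‖v‖))) ^ 2 := by
          rw [mul_pow (d : ℝ) (d * (x * ‖v‖))]
          refine mul_le_mul_of_nonneg_right ?_ (sq_nonneg _)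
          rcases Nat.eq_zero_or_pos d with rfl | hd
          · simp
          · exact le_self_pow₀ (by exact_mod_cast hd) two_ne_zero
  calc _ = ‖Matrix.toEuclideanLin A v‖ := rfl
    _ ≤ _ := h2
    _ = _ := by ring

theorem exists_conjBound_eq (d : ℕ) : ∃ (K : ℝ) (p : ℕ), 0 ≤ K ∧ ∀ R : ℝ,
    conjBound d ((d * d).factorial * (d * R) ^ (d * d)) = K * R ^ p := by
  let c₁ : ℝ := (d * d : ℕ) * ((d * d).factorial * (d : ℝ) ^ (d * d))
  let c₂ : ℝ := d.factorial * (2 * d.factorial * (d * c₁)) ^ d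
  refine ⟨d * ((d * (c₂ * c₁)) * (d.factorial * c₂ ^ d)),
    d * d * d + d * d + d * d * d * d, by positivity, fun R => ?_⟩
  have h1 : frameBound d ((d * d).factorial * (d * R) ^ (d * d)) = c₁ * R ^ (d * d) := by
    simp only [frameBound, c₁, mul_pow]
    ring
  have h2 : reducedBound d ((d * d).factorial * (d * R) ^ (d * d)) = c₂ * R ^ (d * d * d) := by
    rw [reducedBound, indexBound, h1, pow_mul R (d * d) d]
    simp only [c₂, mul_pow]
    ring
  rw [conjBound, h1, h2, mul_pow c₂, ← pow_mul, pow_add, pow_add]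
  ring

theorem exists_conj_le_pow (hd : 2 ≤ d) : ∃ (K : ℝ) (p : ℕ), 0 ≤ K ∧
    ∀ S : Set (Matrix.SpecialLinearGroup (Fin d) ℤ), 1 ∈ S →
      ZariskiDenseSLZ d (Subgroup.closure S) → ∀ R : ℝ, 0 < R →
      (∀ g ∈ S ^ (3 * (d * d)), LamZ g ≤ R) →
      ∃ h : Matrix.SpecialLinearGroup (Fin d) ℤ, ∀ σ ∈ S, ∀ i j,
        |matCast ℝ (h * σ * h⁻¹) i j| ≤ K * R ^ p := by
  obtain ⟨K, p, hK, hconj⟩ := exists_conjBound_eq d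
  refine ⟨K, p, hK, fun S h1 hS R hR hΛ => ?_⟩
  have : NeZero d := ⟨by omega⟩
  have hN : 0 < d * d := Nat.mul_pos (by omega) (by omega)
  have : Nonempty (Fin (d * d)) := ⟨⟨0, hN⟩⟩
  have hd0 : (0 : ℝ) < d := by exact_mod_cast Nat.pos_of_ne_zero (NeZero.ne d)
  obtain ⟨a, haS, hli⟩ := exists_linearIndependent_mem_pow hd h1 hS
  have htr : ∀ g ∈ S ^ (3 * (d * d)),
      |((g : Matrix (Fin d) (Fin d) ℤ).trace : ℝ)| ≤ d * R := fun g hg =>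
    (abs_trace_le g).trans (by gcongr; exact hΛ g hg)
  have htwo : ∀ x ∈ S ^ (d * d), ∀ y ∈ S ^ (d * d), x * y ∈ S ^ (2 * (d * d)) := by
    intro x hx y hy
    rw [two_mul, pow_add]
    exact Set.mul_mem_mul hx hy
  obtain ⟨h, hh⟩ := exists_conj_le hli (Fintype.card_fin _) (X := S ^ (d * d)) haS
    (C := (d * d).factorial * (d * R) ^ (d * d)) (by positivity) (fun x hx i =>
      exists_coeff_le_of_trace_le hli (Fintype.card_fin _)
        (fun j k => htr (a j * a k)
          (Set.pow_subset_pow_right h1 (by omega) (htwo _ (haS j) _ (haS k))))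
        (x * a i) (fun j => htr (a j * (x * a i)) (by
          rw [show 3 * (d * d) = d * d + 2 * (d * d) by ring, pow_add]
          exact Set.mul_mem_mul (haS j) (htwo _ hx _ (haS i)))))
  refine ⟨h, fun σ hσ i j => ?_⟩
  rw [← hconj]
  exact hh σ (Set.subset_pow h1 hN.ne' hσ) i j

theorem not_zariskiDense_of_finite (hd : 2 ≤ d)
    {Δ : Subgroup (Matrix.SpecialLinearGroup (Fin d) ℤ)}
    (hfin : (Δ : Set (Matrix.SpecialLinearGroup (Fin d) ℤ)).Finite) : ¬ ZariskiDenseSLZ d Δ := by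
  intro hΔ
  let i₀ : Fin d := ⟨0, by omega⟩
  let i₁ : Fin d := ⟨1, by omega⟩
  have hne : i₀ ≠ i₁ := by simp [i₀, i₁]
  let vals : Finset ℤ := hfin.toFinset.image
    fun γ : Matrix.SpecialLinearGroup (Fin d) ℤ => (γ : Matrix (Fin d) (Fin d) ℤ) i₀ i₁
  obtain ⟨t, ht⟩ := Infinite.exists_notMem_finset vals
  have h1 := hΔ (∏ v ∈ vals, (MvPolynomial.X (i₀, i₁) - MvPolynomial.C (v : ℚ))) ?_
    (Matrix.SpecialLinearGroup.transvection hne (t : ℂ))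
  · rw [map_prod, Finset.prod_eq_zero_iff] at h1
    obtain ⟨v, hv, h2⟩ := h1
    rw [Matrix.SpecialLinearGroup.transvection_coe] at h2
    simp [Matrix.one_apply_ne hne, sub_eq_zero] at h2
    exact ht (h2 ▸ hv)
  · intro γ hγ
    rw [map_prod]
    refine Finset.prod_eq_zero (Finset.mem_image_of_mem _ (hfin.mem_toFinset.2 hγ)) ?_
    simp

theorem closure_subset_of_finite {G : Type*} [Group G] {S T : Set G} (hT : T.Finite)
    (h1 : 1 ∈ T) (hS : ∀ σ ∈ S, ∀ x ∈ T, σ * x ∈ T) : (Subgroup.closure S : Set G) ⊆ T := by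
  intro g hg
  suffices h : ∀ x ∈ T, g * x ∈ T by simpa using h 1 h1
  induction hg using Subgroup.closure_induction with
  | mem σ hσ => exact hS σ hσ
  | one => simp
  | mul g h _ _ ihg ihh =>
    intro x hx
    rw [mul_assoc]
    exact ihg _ (ihh _ hx)
  | inv g _ ih =>
    intro x hx
    obtain ⟨y, hy, rfl⟩ := Set.surj_on_of_inj_on_of_ncard_le (fun y _ => g * y) ih
      (fun _ _ _ _ h => mul_left_cancel h) le_rfl hT x hx
    simpa using hy

theorem exists_le_LamZ (hd : 2 ≤ d) {S : Set (Matrix.SpecialLinearGroup (Fin d) ℤ)}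
    (h1 : 1 ∈ S) (hS : ZariskiDenseSLZ d (Subgroup.closure S)) (M : ℝ) :
    ∃ n, ∃ a ∈ S ^ n, M ≤ LamZ a := by
  by_contra! hlt
  have : NeZero d := ⟨by omega⟩
  obtain ⟨a, haS, hli⟩ := exists_linearIndependent_mem_pow hd h1 hS
  let T : Set (Matrix.SpecialLinearGroup (Fin d) ℤ) := ⋃ n, S ^ n
  let τ : Matrix.SpecialLinearGroup (Fin d) ℤ → Fin (d * d) → ℤ := fun x i =>
    ((a i : Matrix (Fin d) (Fin d) ℤ) * (x : Matrix (Fin d) (Fin d) ℤ)).trace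
  have hτ : Function.Injective τ := by
    intro x y hxy
    refine Subtype.ext (sub_eq_zero.1 (eq_zero_of_trace_mul_eq_zero hli (Fintype.card_fin _) _
      fun i => ?_))
    rw [mul_sub, Matrix.trace_sub, sub_eq_zero]
    exact congrFun hxy i
  have hT : T.Finite := by
    refine Set.Finite.of_finite_image (f := τ) ?_ hτ.injOn
    refine (Set.finite_Icc (fun _ => -⌈(d * M : ℝ)⌉) (fun _ => ⌈(d * M : ℝ)⌉)).subset ?_
    rintro _ ⟨x, hx, rfl⟩
    obtain ⟨n, hn⟩ := Set.mem_iUnion.1 hx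
    have h2 : ∀ i, |τ x i| ≤ ⌈(d * M : ℝ)⌉ := by
      intro i
      have hmem : a i * x ∈ S ^ (d * d + n) := by
        rw [pow_add]
        exact Set.mul_mem_mul (haS i) hn
      have h3 : |((τ x i : ℤ) : ℝ)| ≤ d * M :=
        (abs_trace_le (a i * x)).trans (by gcongr; exact (hlt _ _ hmem).le)
      exact_mod_cast h3.trans (Int.le_ceil _)
    exact ⟨fun i => (abs_le.1 (h2 i)).1, fun i => (abs_le.1 (h2 i)).2⟩
  refine not_zariskiDense_of_finite hd (hT.subset (closure_subset_of_finite hT ?_ ?_)) hS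
  · exact Set.mem_iUnion.2 ⟨0, by simp⟩
  · intro σ hσ x hx
    obtain ⟨n, hn⟩ := Set.mem_iUnion.1 hx
    refine Set.mem_iUnion.2 ⟨n + 1, ?_⟩
    rw [pow_succ']
    exact Set.mul_mem_mul hσ hn

theorem finite_setOf_matCast_le (B : ℝ) :
    {g : Matrix.SpecialLinearGroup (Fin d) ℤ | ∀ i j, |matCast ℝ g i j| ≤ B}.Finite := by
  refine Set.Finite.of_finite_image (f := fun g i j => (g : Matrix (Fin d) (Fin d) ℤ) i j) ?_
    (fun x _ y _ h => Subtype.ext h)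
  refine (Set.finite_Icc (fun _ _ => -⌈B⌉) (fun _ _ => ⌈B⌉)).subset ?_
  rintro _ ⟨g, hg, rfl⟩
  have h1 : ∀ i j, |(g : Matrix (Fin d) (Fin d) ℤ) i j| ≤ ⌈B⌉ := by
    intro i j
    have h2 : |(((g : Matrix (Fin d) (Fin d) ℤ) i j : ℤ) : ℝ)| ≤ B := hg i j
    exact_mod_cast h2.trans (Int.le_ceil B)
  exact ⟨fun i j => (abs_le.1 (h1 i j)).1, fun i j => (abs_le.1 (h1 i j)).2⟩

/-- Among the finitely many sets of matrices with bounded entries, the word length needed to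
reach a given spectral radius is uniformly bounded. -/
theorem exists_uniform_length (B M : ℝ) :
    ∃ r : ℕ, ∀ S : Set (Matrix.SpecialLinearGroup (Fin d) ℤ), 1 ∈ S →
      (∀ g ∈ S, ∀ i j, |matCast ℝ g i j| ≤ B) → (∃ n, ∃ a ∈ S ^ n, M ≤ LamZ a) →
      ∃ a ∈ S ^ r, M ≤ LamZ a := by
  classical
  let k : Set (Matrix.SpecialLinearGroup (Fin d) ℤ) → ℕ := fun S =>
    if h : ∃ n, ∃ a ∈ S ^ n, M ≤ LamZ a then h.choose else 0
  obtain ⟨r, hr⟩ := ((finite_setOf_matCast_le B).powerset.image k).bddAbove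
  refine ⟨r, fun S h1 hS hex => ?_⟩
  have hk : k S = hex.choose := dif_pos hex
  obtain ⟨a, ha, hM⟩ := hex.choose_spec
  exact ⟨a, Set.pow_subset_pow_right h1 (hk ▸ hr ⟨S, hS, rfl⟩) ha, hM⟩

end UniformEstimates

theorem stmt15 {d : ℕ} (hd : 2 ≤ d) :
    ∃ r : ℕ, ∀ S : Finset (Matrix.SpecialLinearGroup (Fin d) ℤ),
      (1 : Matrix.SpecialLinearGroup (Fin d) ℤ) ∈ S →
      ZariskiDenseSLZ d (Subgroup.closure (S : Set (Matrix.SpecialLinearGroup (Fin d) ℤ))) →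
      ∃ h : Matrix.SpecialLinearGroup (Fin d) ℤ,
        ∀ σ ∈ S, ∃ a ∈ (S : Set (Matrix.SpecialLinearGroup (Fin d) ℤ)) ^ r,
          opNormR (intMat h * intMat σ *
              intMat h⁻¹) ≤
            LamZ a := by
  have : NeZero d := ⟨by omega⟩
  obtain ⟨K, p, hK, hmain⟩ := exists_conj_le_pow hd
  obtain ⟨r₀, hr₀⟩ := exists_uniform_length (d := d) (K * 2 ^ p) (d * d * (K * 2 ^ p))
  obtain ⟨q, hq⟩ := pow_unbounded_of_one_lt (d * d * K) (one_lt_two (α := ℝ))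
  set n := 3 * (d * d) with hn
  refine ⟨max (n * (q + p)) r₀, fun S h1 hS => ?_⟩
  have h1' : (1 : Matrix.SpecialLinearGroup (Fin d) ℤ) ∈
      (S : Set (Matrix.SpecialLinearGroup (Fin d) ℤ)) := h1
  obtain ⟨g, hg, hgmax⟩ := Set.exists_max_image
    ((S : Set (Matrix.SpecialLinearGroup (Fin d) ℤ)) ^ n) LamZ
    (by classical rw [← Finset.coe_pow]; exact Finset.finite_toSet _)
    ⟨1, Set.one_mem_pow h1'⟩
  have hnorm : ∀ (h σ : Matrix.SpecialLinearGroup (Fin d) ℤ) (x : ℝ), 0 ≤ x →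
      (∀ i j, |matCast ℝ (h * σ * h⁻¹) i j| ≤ x) →
      opNormR (intMat h * intMat σ * intMat h⁻¹) ≤ d * d * x := by
    intro h σ x hx hle
    refine opNormR_le hx ?_
    rwa [map_mul, map_mul] at hle
  rcases le_total 2 (LamZ g) with hR | hR
  · obtain ⟨h, hh⟩ := hmain S h1' hS (LamZ g) (by linarith) hgmax
    refine ⟨h, fun σ hσ => ⟨g ^ (q + p), Set.pow_subset_pow_right h1' (le_max_left _ _) ?_, ?_⟩⟩
    · rw [pow_mul]
      exact Set.pow_mem_pow hg
    · calc opNormR (intMat h * intMat σ * intMat h⁻¹) ≤ d * d * (K * LamZ g ^ p) :=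
            hnorm h σ _ (by have := LamZ_nonneg g; positivity) (hh σ hσ)
        _ = d * d * K * LamZ g ^ p := by ring
        _ ≤ LamZ g ^ q * LamZ g ^ p := by
            have := LamZ_nonneg g
            gcongr
            exact hq.le.trans (by gcongr)
        _ = LamZ g ^ (q + p) := (pow_add _ _ _).symm
        _ ≤ LamZ (g ^ (q + p)) := LamZ_pow_le g _
  · obtain ⟨h, hh⟩ := hmain S h1' hS 2 two_pos fun x hx => (hgmax x hx).trans hR
    obtain ⟨l, b, hb, hbM⟩ := exists_le_LamZ hd h1' hS (d * d * (K * 2 ^ p))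
    obtain ⟨a, ha, haM⟩ := hr₀
      (MulAut.conj h '' (S : Set (Matrix.SpecialLinearGroup (Fin d) ℤ)))
      ⟨1, h1', map_one _⟩
      (by rintro _ ⟨σ, hσ, rfl⟩; exact hh σ hσ)
      ⟨l, MulAut.conj h b, by rw [← Set.image_pow]; exact ⟨b, hb, rfl⟩,
        by rwa [MulAut.conj_apply, LamZ_conj]⟩
    rw [← Set.image_pow] at ha
    obtain ⟨a, ha, rfl⟩ := ha
    rw [MulAut.conj_apply, LamZ_conj] at haM
    exact ⟨h, fun σ hσ => ⟨a, Set.pow_subset_pow_right h1' (le_max_right _ _) ha,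
      (hnorm h σ _ (by positivity) (hh σ hσ)).trans haM⟩⟩
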